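/- arXiv:2401.15771 — 3 statements merged into one kernel-verified Lean document; each statement's English description precedes it below -/
import Mathlib

section
/- Let ξ_1, …, ξ_n be points of ℝ × ℝ^d (written ξ_i = (y_i, x_i)), let h(θ, (y, x)) = (y − θᵀx)² be the squared loss, let α > 0, and let p₀ be the standard Gaussian measure N(0, I_{d+1}) on ℝ × ℝ^d (viewing θ ∈ ℝ^d as coefficients on x). If θ̂ ∈ Θ ⊆ ℝ^d minimizes the map θ ↦ (n/(α+n))·(1/n)∑_{i=1}^n (y_i − θᵀx_i)² + (α/(α+n))·∫ (y − θᵀx)² dp₀(y, x) over Θ, then θ̂ also minimizes the Ridge objective θ ↦ (1/n)∑_{i=1}^n (y_i − θᵀx_i)² + (α/n)·‖θ‖₂² over Θ. -/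
open MeasureTheory ProbabilityTheory

/-- A linear form has mean zero under a product of standard real Gaussians. -/
lemma integral_sum_mul_pi_gaussianReal {ι : Type*} [Fintype ι] (θ : ι → ℝ) :
    ∫ x, ∑ j, θ j * x j ∂(Measure.pi fun _ : ι => gaussianReal 0 1) = 0 := by
  have hint (j : ι) : Integrable (fun x : ι → ℝ => x j)
      (Measure.pi fun _ : ι => gaussianReal 0 1) :=
    ((memLp_id_gaussianReal 1).comp_measurePreserving
      (measurePreserving_eval (fun _ : ι => gaussianReal 0 1) j)).integrable le_rfl
  rw [integral_finsetSum _ fun j _ => (hint j).const_mul _]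
  refine Finset.sum_eq_zero fun j _ => ?_
  rw [integral_const_mul,
    integral_comp_eval (μ := fun _ : ι => gaussianReal 0 1) (f := fun t : ℝ => t) (by fun_prop),
    integral_id_gaussianReal, mul_zero]

/-- A linear form is square integrable under a product of standard real Gaussians. -/
lemma memLp_sum_mul_pi_gaussianReal {ι : Type*} [Fintype ι] (θ : ι → ℝ) :
    MemLp (fun x : ι → ℝ => ∑ j, θ j * x j) 2 (Measure.pi fun _ : ι => gaussianReal 0 1) :=
  memLp_finsetSum _ fun j _ =>
    ((memLp_id_gaussianReal 2).comp_measurePreserving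
      (measurePreserving_eval (fun _ : ι => gaussianReal 0 1) j)).const_mul (θ j)

/-- The variance of a linear form under a product of standard real Gaussians is the squared
Euclidean norm of its coefficients. -/
lemma variance_sum_mul_pi_gaussianReal {ι : Type*} [Fintype ι] (θ : ι → ℝ) :
    Var[fun x => ∑ j, θ j * x j; Measure.pi fun _ : ι => gaussianReal 0 1] =
      ∑ j, θ j ^ 2 := by
  have h := variance_sum_pi (μ := fun _ : ι => gaussianReal 0 1) (X := fun j t => θ j * t)
    fun j => (memLp_id_gaussianReal 2).const_mul (θ j)
  have hsum : (∑ j, fun x : ι → ℝ => θ j * x j) = fun x => ∑ j, θ j * x j := by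
    ext x
    simp
  rw [hsum] at h
  refine h.trans (Finset.sum_congr rfl fun j _ => ?_)
  rw [variance_const_mul (θ j) (fun t => t), variance_fun_id_gaussianReal, NNReal.coe_one, mul_one]

/-- The squared-loss risk of a linear predictor under the standard Gaussian measure. -/
lemma integral_sq_sub_sum_mul_gaussianReal {ι : Type*} [Fintype ι] (θ : ι → ℝ) :
    ∫ ξ, (ξ.1 - ∑ j, θ j * ξ.2 j) ^ 2
        ∂((gaussianReal 0 1).prod (Measure.pi fun _ : ι => gaussianReal 0 1)) =
      1 + ∑ j, θ j ^ 2 := by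
  have hX : MemLp (fun t : ℝ => t) 2 (gaussianReal 0 1) := memLp_id_gaussianReal 2
  have hY := memLp_sum_mul_pi_gaussianReal θ
  have hX' := hX.comp_fst (Measure.pi fun _ : ι => gaussianReal 0 1)
  have hY' := hY.comp_snd (gaussianReal 0 1)
  rw [← variance_of_integral_eq_zero (X := fun ξ : ℝ × (ι → ℝ) => ξ.1 - ∑ j, θ j * ξ.2 j)
    (hX'.sub hY').aemeasurable]
  · have h := variance_add_prod hX hY.neg
    simp only [Pi.neg_apply, ← sub_eq_add_neg, variance_neg, variance_fun_id_gaussianReal,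
      variance_sum_mul_pi_gaussianReal, NNReal.coe_one] at h
    exact h
  · rw [integral_sub (hX'.integrable one_le_two) (hY'.integrable one_le_two),
      integral_fun_fst (fun t : ℝ => t), integral_fun_snd (fun x : ι → ℝ => ∑ j, θ j * x j),
      integral_id_gaussianReal, integral_sum_mul_pi_gaussianReal]
    simp

/-- **Equivalence of the ambiguity-neutral DP criterion with Ridge regression**
(Proposition `pro:equivalence_regularization`, part 1).  If `θ̂` minimizes over `Θ` the
ambiguity-neutral criterion `θ ↦ (n/(α+n))·R_emp(θ) + (α/(α+n))·R_{p₀}(θ)` for the squared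
loss `h(θ,(y,x)) = (y − θᵀx)²`, where `p₀` is the standard Gaussian `N(0, I_{d+1})`
(a product of `d+1` independent standard real Gaussians), then `θ̂` also minimizes the
Ridge objective `θ ↦ (1/n)·∑ᵢ (yᵢ − θᵀxᵢ)² + (α/n)·‖θ‖₂²` over `Θ`. -/
theorem ridge_equivalence (n d : ℕ) (hn : 0 < n)
    (y : Fin n → ℝ) (x : Fin n → Fin d → ℝ)
    (α : ℝ) (hα : 0 < α)
    (Θ : Set (Fin d → ℝ)) (θhat : Fin d → ℝ) (hθhat : θhat ∈ Θ)
    (p₀ : Measure (ℝ × (Fin d → ℝ)))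
    (hp₀ : p₀ = (gaussianReal 0 1).prod (Measure.pi fun _ : Fin d => gaussianReal 0 1))
    (hmin : ∀ θ ∈ Θ,
      ((n : ℝ) / (α + n)) * ((1 / n) * ∑ i, (y i - ∑ j, θhat j * x i j) ^ 2)
          + (α / (α + n)) * ∫ ξ, (ξ.1 - ∑ j, θhat j * ξ.2 j) ^ 2 ∂p₀
        ≤ ((n : ℝ) / (α + n)) * ((1 / n) * ∑ i, (y i - ∑ j, θ j * x i j) ^ 2)
          + (α / (α + n)) * ∫ ξ, (ξ.1 - ∑ j, θ j * ξ.2 j) ^ 2 ∂p₀) :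
    ∀ θ ∈ Θ,
      (1 / n) * ∑ i, (y i - ∑ j, θhat j * x i j) ^ 2 + (α / n) * ∑ j, (θhat j) ^ 2
        ≤ (1 / n) * ∑ i, (y i - ∑ j, θ j * x i j) ^ 2 + (α / n) * ∑ j, (θ j) ^ 2 := by
  intro θ hθ
  have hn' : (0 : ℝ) < n := Nat.cast_pos.mpr hn
  have h := hmin θ hθ
  rw [hp₀, integral_sq_sub_sum_mul_gaussianReal, integral_sq_sub_sum_mul_gaussianReal] at h
  have criterion_eq (r s : ℝ) : (n : ℝ) / (α + n) * r + α / (α + n) * (1 + s) =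
      n / (α + n) * (r + α / n * s) + α / (α + n) := by
    field_simp
    ring
  rw [criterion_eq, criterion_eq, add_le_add_iff_right] at h
  exact le_of_mul_le_mul_left h (by positivity)
end

section
/- Let ξ_1, …, ξ_n be points of ℝ × ℝ^d (written ξ_i = (y_i, x_i)), let h(θ, (y, x)) = (y − θᵀx)² be the squared loss, and let α > 0. For θ ∈ ℝ^d with all coordinates nonzero, let p₀(θ) be the Gaussian measure on ℝ × ℝ^d under which y, x_1, …, x_d are independent, y ~ N(0, 1), and x_j ~ N(0, |θ_j|^{-1}). If θ̂ ∈ Θ ⊆ ℝ^d minimizes the map θ ↦ (n/(α+n))·(1/n)∑_{i=1}^n (y_i − θᵀx_i)² + (α/(α+n))·∫ (y − θᵀx)² dp₀(θ)(y, x) over Θ, then θ̂ also minimizes the LASSO objective θ ↦ (1/n)∑_{i=1}^n (y_i − θᵀx_i)² + (α/n)·‖θ‖₁ over Θ. -/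
open MeasureTheory ProbabilityTheory

/-- The squared-loss risk of the linear predictor `w` when the response and the features are
independent centered Gaussians. -/
lemma integral_sub_sum_sq_gaussianReal {ι : Type*} [Fintype ι] (s : NNReal) (v : ι → NNReal)
    (w : ι → ℝ) :
    ∫ ξ, (ξ.1 - ∑ j, w j * ξ.2 j) ^ 2
        ∂((gaussianReal 0 s).prod (Measure.pi fun j => gaussianReal 0 (v j)))
      = s + ∑ j, w j ^ 2 * v j := by
  have hfst : MemLp (fun t : ℝ => t) 2 (gaussianReal 0 s) := memLp_id_gaussianReal' 2 (by simp)
  have hcoord (j : ι) : MemLp (fun t : ℝ => -w j * t) 2 (gaussianReal 0 (v j)) :=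
    (memLp_id_gaussianReal' 2 (by simp)).const_mul _
  have hterm (j : ι) : MemLp (fun z : ι → ℝ => -w j * z j) 2
      (Measure.pi fun j => gaussianReal 0 (v j)) :=
    (hcoord j).comp_measurePreserving (measurePreserving_eval _ j)
  have hsum : MemLp (∑ j, fun z : ι → ℝ => -w j * z j) 2
      (Measure.pi fun j => gaussianReal 0 (v j)) :=
    memLp_finsetSum' _ fun j _ => hterm j
  have hmean : ∫ z, (∑ j, fun z : ι → ℝ => -w j * z j) z
      ∂(Measure.pi fun j => gaussianReal 0 (v j)) = 0 := by
    simp only [Finset.sum_apply]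
    rw [integral_finsetSum _ fun j _ => (hterm j).integrable one_le_two]
    refine Finset.sum_eq_zero fun j _ => ?_
    rw [integral_const_mul, integral_eval]
    simp
  have hvar := variance_add_prod hfst hsum
  rw [variance_sum_pi (X := fun j t => -w j * t) hcoord] at hvar
  simp only [variance_const_mul _ fun t : ℝ => t, variance_fun_id_gaussianReal, neg_sq] at hvar
  rw [← hvar, variance_of_integral_eq_zero]
  · simp [sub_eq_add_neg]
  · exact ((hfst.comp_fst _).add (hsum.comp_snd _)).aemeasurable
  · rw [integral_add ((hfst.comp_fst _).integrable one_le_two)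
      ((hsum.comp_snd _).integrable one_le_two), integral_fun_fst (fun t : ℝ => t),
      integral_fun_snd (∑ j, fun z : ι → ℝ => -w j * z j), hmean]
    simp

/-- **Equivalence of the ambiguity-neutral DP criterion with LASSO regression**
(Proposition `pro:equivalence_regularization`, part 2).  For `θ` with all coordinates nonzero,
let `p₀ θ` be the Gaussian measure on `ℝ × ℝᵈ` under which `y, x₁, …, x_d` are independent,
`y ~ N(0,1)` and `xⱼ ~ N(0, |θⱼ|⁻¹)`.  If `θ̂` minimizes over `Θ` the ambiguity-neutral
criterion `θ ↦ (n/(α+n))·R_emp(θ) + (α/(α+n))·R_{p₀(θ)}(θ)` for the squared loss, then `θ̂`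
also minimizes the LASSO objective `θ ↦ (1/n)·∑ᵢ (yᵢ − θᵀxᵢ)² + (α/n)·‖θ‖₁` over `Θ`. -/
theorem lasso_equivalence (n d : ℕ) (hn : 0 < n)
    (y : Fin n → ℝ) (x : Fin n → Fin d → ℝ)
    (α : ℝ) (hα : 0 < α)
    (Θ : Set (Fin d → ℝ)) (hΘ : ∀ θ ∈ Θ, ∀ j, θ j ≠ 0)
    (θhat : Fin d → ℝ) (hθhat : θhat ∈ Θ)
    (p₀ : (Fin d → ℝ) → Measure (ℝ × (Fin d → ℝ)))
    (hp₀ : ∀ θ : Fin d → ℝ, (∀ j, θ j ≠ 0) →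
      p₀ θ = (gaussianReal 0 1).prod
        (Measure.pi fun j : Fin d => gaussianReal 0 (Real.toNNReal |θ j|⁻¹)))
    (hmin : ∀ θ ∈ Θ,
      ((n : ℝ) / (α + n)) * ((1 / n) * ∑ i, (y i - ∑ j, θhat j * x i j) ^ 2)
          + (α / (α + n)) * ∫ ξ, (ξ.1 - ∑ j, θhat j * ξ.2 j) ^ 2 ∂(p₀ θhat)
        ≤ ((n : ℝ) / (α + n)) * ((1 / n) * ∑ i, (y i - ∑ j, θ j * x i j) ^ 2)
          + (α / (α + n)) * ∫ ξ, (ξ.1 - ∑ j, θ j * ξ.2 j) ^ 2 ∂(p₀ θ)) :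
    ∀ θ ∈ Θ,
      (1 / n) * ∑ i, (y i - ∑ j, θhat j * x i j) ^ 2 + (α / n) * ∑ j, |θhat j|
        ≤ (1 / n) * ∑ i, (y i - ∑ j, θ j * x i j) ^ 2 + (α / n) * ∑ j, |θ j| := by
  have hrisk (θ : Fin d → ℝ) (hθ : ∀ j, θ j ≠ 0) :
      ∫ ξ, (ξ.1 - ∑ j, θ j * ξ.2 j) ^ 2 ∂(p₀ θ) = 1 + ∑ j, |θ j| := by
    rw [hp₀ θ hθ, integral_sub_sum_sq_gaussianReal, NNReal.coe_one]
    congr 1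
    refine Finset.sum_congr rfl fun j _ => ?_
    have hj : |θ j| ≠ 0 := abs_ne_zero.mpr (hθ j)
    rw [Real.coe_toNNReal _ (by positivity), ← sq_abs]
    field_simp
  have hn' : (0 : ℝ) < n := by exact_mod_cast hn
  have hrescale (A S : ℝ) : A + α / n * S
      = (α + n) / n * (n / (α + n) * A + α / (α + n) * (1 + S)) - α / n := by
    field_simp
    ring
  intro θ hθ
  have h := hmin θ hθ
  rw [hrisk _ (hΘ _ hθhat), hrisk _ (hΘ _ hθ)] at h
  rw [hrescale, hrescale]
  gcongr
end

section
/- Let h : Θ × Ξ → [0, K], let p_* be a probability measure on Ξ, and for each n let p_emp,n be the empirical measure of a sample of size n, assume sup_{θ∈Θ} |R_{p_emp,n}(θ) − R_{p_*}(θ)| → 0 as n → ∞, and fix α > 0 and a probability measure p₀ on Ξ. For each n let φ_n : [0, K] → ℝ₊ be convex, strictly increasing, and twice continuously differentiable on (0, K), with (1) γ*_{φ_n} := sup_{(0,K)} φ_n''/φ_n' → 0, (2) sup_{n≥1} M_{φ_n} < ∞ where M_{φ_n} := sup_{(0,K)} φ_n', and (3) sup_{t∈[0,K]} |φ_n(t)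 − t| → 0. Let Q_n be a probability measure on probability measures on Ξ with ∫ R_p(θ) dQ_n(p) = (n/(α+n))·R_{p_emp,n}(θ) + (α/(α+n))·R_{p₀}(θ) for all θ, set V_n(θ) = ∫ φ_n(R_p(θ)) dQ_n(p), and let θ_n minimize V_n over Θ and θ_* minimize R_{p_*} over Θ. Then R_{p_*}(θ_n) → R_{p_*}(θ_*) and V_n(θ_n) → R_{p_*}(θ_*) as n → ∞. -/
open MeasureTheory Filter Topology

/-- The space of probability measures, as a subtype of measures, inherits the σ-algebra of
the space of measures. -/
instance probabilityMeasureMeasurableSpace {Ω : Type*} [MeasurableSpace Ω] :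
    MeasurableSpace (ProbabilityMeasure Ω) :=
  Subtype.instMeasurableSpace

/-- If `Fₙ → G` uniformly, the minimizers `xₙ` of `Fₙ` are asymptotically optimal for `G`, and the
minimal values converge. -/
theorem tendsto_of_tendstoUniformly_of_isMin {X : Type*} {F : ℕ → X → ℝ} {G : X → ℝ}
    (hFG : TendstoUniformly F G atTop) {x : ℕ → X} (hx : ∀ n y, F n (x n) ≤ F n y)
    {z : X} (hz : ∀ y, G z ≤ G y) :
    Tendsto (fun n => G (x n)) atTop (𝓝 (G z)) ∧
      Tendsto (fun n => F n (x n)) atTop (𝓝 (G z)) := by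
  rw [Metric.tendstoUniformly_iff] at hFG
  simp only [Real.dist_eq] at hFG
  constructor <;> rw [Metric.tendsto_atTop'] <;> intro ε hε <;>
    obtain ⟨N, hN⟩ := eventually_atTop.1 (hFG (ε / 2) (half_pos hε)) <;>
    refine ⟨N, fun n hn => ?_⟩ <;>
    have h1 := abs_lt.1 (hN n hn.le (x n)) <;>
    have h2 := abs_lt.1 (hN n hn.le z) <;>
    rw [Real.dist_eq, abs_lt] <;>
    constructor <;> linarith [hx n z, hz (x n)]

theorem integral_mem_Icc_of_forall_mem_Icc {Ω : Type*} [MeasurableSpace Ω] {μ : Measure Ω}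
    [IsProbabilityMeasure μ] {K : ℝ} {f : Ω → ℝ} (hf : ∀ x, f x ∈ Set.Icc 0 K)
    (hfm : Measurable f) : ∫ x, f x ∂μ ∈ Set.Icc 0 K := by
  have hint : Integrable f μ := Integrable.of_mem_Icc 0 K hfm.aemeasurable (ae_of_all _ hf)
  refine ⟨integral_nonneg fun x => (hf x).1, ?_⟩
  simpa using integral_mono hint (integrable_const K) fun x => (hf x).2

theorem measurable_integral_probabilityMeasure {Ω : Type*} [MeasurableSpace Ω] {f : Ω → ℝ}
    (hf : Measurable f) (hf0 : ∀ x, 0 ≤ f x) :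
    Measurable fun p : ProbabilityMeasure Ω => ∫ x, f x ∂(p : Measure Ω) := by
  have heq : (fun p : ProbabilityMeasure Ω => ∫ x, f x ∂(p : Measure Ω)) =
      fun p : ProbabilityMeasure Ω => (∫⁻ x, ENNReal.ofReal (f x) ∂(p : Measure Ω)).toReal :=
    funext fun p => integral_eq_lintegral_of_nonneg_ae (ae_of_all _ hf0) hf.aestronglyMeasurable
  rw [heq]
  exact ((Measure.measurable_lintegral hf.ennreal_ofReal).comp measurable_subtype_coe).ennreal_toReal

/-- A function that is monotone on `[0, K]` composed with a measurable function valued in `[0, K]`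
is integrable for any probability measure. -/
theorem integrable_comp_of_monotoneOn_Icc {Ω : Type*} [MeasurableSpace Ω] {μ : Measure Ω}
    [IsProbabilityMeasure μ] {K : ℝ} (hK : 0 ≤ K) {g : ℝ → ℝ} (hg : MonotoneOn g (Set.Icc 0 K))
    {f : Ω → ℝ} (hf : ∀ x, f x ∈ Set.Icc 0 K) (hfm : Measurable f) :
    Integrable (fun x => g (f x)) μ := by
  have hmono : Monotone fun t => g (Set.projIcc 0 K hK t) := fun a b hab =>
    hg (Set.projIcc 0 K hK a).2 (Set.projIcc 0 K hK b).2 (Set.monotone_projIcc hK hab)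
  have heq : (fun x => g (f x)) = fun x => g (Set.projIcc 0 K hK (f x)) := by
    funext x
    rw [Set.projIcc_of_mem hK (hf x)]
  have hmeas : Measurable fun x => g (f x) := by
    rw [heq]
    exact hmono.measurable.comp hfm
  exact Integrable.of_mem_Icc (g 0) (g K) hmeas.aemeasurable (ae_of_all _ fun x =>
    ⟨hg ⟨le_rfl, hK⟩ (hf x) (hf x).1, hg (hf x) ⟨hK, le_rfl⟩ (hf x).2⟩)

/-- Changing the integrand by at most `ε` on `[0, K]` changes the mean by at most `ε`. -/
theorem abs_integral_comp_sub_integral_le {Ω : Type*} [MeasurableSpace Ω] {μ : Measure Ω}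
    [IsProbabilityMeasure μ] {K ε : ℝ} (hK : 0 ≤ K) {g : ℝ → ℝ}
    (hg : MonotoneOn g (Set.Icc 0 K)) (hgε : ∀ t ∈ Set.Icc 0 K, |g t - t| ≤ ε)
    {f : Ω → ℝ} (hf : ∀ x, f x ∈ Set.Icc 0 K) (hfm : Measurable f) :
    |(∫ x, g (f x) ∂μ) - ∫ x, f x ∂μ| ≤ ε := by
  rw [← integral_sub (integrable_comp_of_monotoneOn_Icc hK hg hf hfm)
    (Integrable.of_mem_Icc 0 K hfm.aemeasurable (ae_of_all _ hf))]
  simpa using norm_integral_le_of_norm_le_const (μ := μ) (f := fun x => g (f x) - f x)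
    (ae_of_all _ fun x => hgε _ (hf x))

theorem average_mem_Icc {K : ℝ} (hK : 0 ≤ K) {n : ℕ} {a : Fin n → ℝ}
    (ha : ∀ i, a i ∈ Set.Icc 0 K) : (1 / (n : ℝ)) * ∑ i, a i ∈ Set.Icc 0 K := by
  refine ⟨mul_nonneg (by positivity) (Finset.sum_nonneg fun i _ => (ha i).1), ?_⟩
  rw [one_div_mul_eq_div]
  refine div_le_of_le_mul₀ n.cast_nonneg hK ?_
  calc ∑ i, a i ≤ ∑ _i : Fin n, K := Finset.sum_le_sum fun i _ => (ha i).2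
    _ = K * n := by simp [mul_comm]

/-- The mixture `n / (α + n) • a + α / (α + n) • b` is within `α / (α + n) * K` of `a`. -/
theorem abs_mixture_sub_le {α K a b : ℝ} (hα : 0 < α) (n : ℕ) (ha : a ∈ Set.Icc 0 K)
    (hb : b ∈ Set.Icc 0 K) :
    |((n : ℝ) / (α + n)) * a + (α / (α + n)) * b - a| ≤ α / (α + n) * K := by
  have hpos : 0 < α + (n : ℝ) := by positivity
  have heq : ((n : ℝ) / (α + n)) * a + (α / (α + n)) * b - a = α / (α + n) * (b - a) := by
    field_simp
    ring
  rw [heq, abs_mul, abs_of_pos (div_pos hα hpos)]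
  refine mul_le_mul_of_nonneg_left ?_ (div_pos hα hpos).le
  rw [abs_le]
  constructor <;> linarith [ha.1, ha.2, hb.1, hb.2]

/-- **Asymptotic convergence of the smooth criterion and of the excess risk**
(Theorem `thm:uniform_convergence_criterion`).  Assume the empirical risks converge uniformly
to the true risk, and let `φₙ` be convex, strictly increasing, nonnegative, twice continuously
differentiable transformations on `(0,K)` whose Arrow–Pratt coefficients `φₙ''/φₙ'` admit
vanishing uniform bounds `γₙ → 0`, whose derivatives are uniformly bounded, and which converge
uniformly to the identity on `[0,K]`.  If `Qₙ` has predictive-mixture mean risk, `θₙ` minimizes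
`Vₙ(θ) = ∫ φₙ(R_p(θ)) dQₙ(p)` over `Θ` and `θ_*` minimizes `R_{p_*}` over `Θ`, then
`R_{p_*}(θₙ) → R_{p_*}(θ_*)` and `Vₙ(θₙ) → R_{p_*}(θ_*)`. -/
theorem asymptotic_convergence_smooth_criterion
    {Θ : Type*} {Ξ : Type*} [MeasurableSpace Ξ]
    (K : ℝ) (hK : 0 < K)
    (h : Θ → Ξ → ℝ) (hval : ∀ θ ξ, h θ ξ ∈ Set.Icc 0 K) (hmeas : ∀ θ, Measurable (h θ))
    (pstar p₀ : Measure Ξ) [IsProbabilityMeasure pstar] [IsProbabilityMeasure p₀]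
    (α : ℝ) (hα : 0 < α)
    (ξs : (n : ℕ) → Fin n → Ξ)
    (hunif : TendstoUniformly
      (fun (n : ℕ) (θ : Θ) => (1 / (n : ℝ)) * ∑ i, h θ (ξs n i))
      (fun θ => ∫ ξ, h θ ξ ∂pstar) atTop)
    (φn : ℕ → ℝ → ℝ)
    (hφconv : ∀ n, ConvexOn ℝ (Set.Icc 0 K) (φn n))
    (hφmono : ∀ n, StrictMonoOn (φn n) (Set.Icc 0 K))
    (hφpos : ∀ n, ∀ t ∈ Set.Icc 0 K, 0 ≤ φn n t)
    (hφC2 : ∀ n, ContDiffOn ℝ 2 (φn n) (Set.Ioo 0 K))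
    (γφ : ℕ → ℝ)
    (hγbound : ∀ n, ∀ t ∈ Set.Ioo 0 K, deriv (deriv (φn n)) t / deriv (φn n) t ≤ γφ n)
    (hγ0 : Tendsto γφ atTop (𝓝 0))
    (Mφ : ℕ → ℝ) (hMbound : ∀ n, ∀ t ∈ Set.Ioo 0 K, deriv (φn n) t ≤ Mφ n)
    (hMunif : ∃ C : ℝ, ∀ n, Mφ n ≤ C)
    (hid : TendstoUniformlyOn (fun (n : ℕ) (t : ℝ) => φn n t) id atTop (Set.Icc 0 K))
    (Qs : ℕ → Measure (ProbabilityMeasure Ξ))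
    (hQprob : ∀ n, IsProbabilityMeasure (Qs n))
    (hQmean : ∀ (n : ℕ) (θ : Θ),
      (∫ p : ProbabilityMeasure Ξ, ∫ ξ, h θ ξ ∂(p : Measure Ξ) ∂(Qs n))
        = ((n : ℝ) / (α + n)) * ((1 / (n : ℝ)) * ∑ i, h θ (ξs n i))
          + (α / (α + n)) * ∫ ξ, h θ ξ ∂p₀)
    (θn : ℕ → Θ)
    (hθn : ∀ (n : ℕ) (θ : Θ),
      (∫ p : ProbabilityMeasure Ξ, φn n (∫ ξ, h (θn n) ξ ∂(p : Measure Ξ)) ∂(Qs n))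
        ≤ ∫ p : ProbabilityMeasure Ξ, φn n (∫ ξ, h θ ξ ∂(p : Measure Ξ)) ∂(Qs n))
    (θstar : Θ)
    (hθstar : ∀ θ : Θ, (∫ ξ, h θstar ξ ∂pstar) ≤ ∫ ξ, h θ ξ ∂pstar) :
    Tendsto (fun n => ∫ ξ, h (θn n) ξ ∂pstar) atTop (𝓝 (∫ ξ, h θstar ξ ∂pstar))
    ∧ Tendsto
        (fun n => ∫ p : ProbabilityMeasure Ξ,
          φn n (∫ ξ, h (θn n) ξ ∂(p : Measure Ξ)) ∂(Qs n))
        atTop (𝓝 (∫ ξ, h θstar ξ ∂pstar)) := by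
  refine tendsto_of_tendstoUniformly_of_isMin (G := fun θ => ∫ ξ, h θ ξ ∂pstar)
    (F := fun n θ => ∫ p : ProbabilityMeasure Ξ, φn n (∫ ξ, h θ ξ ∂(p : Measure Ξ)) ∂(Qs n))
    ?_ hθn hθstar
  rw [Metric.tendstoUniformly_iff] at hunif ⊢
  rw [Metric.tendstoUniformlyOn_iff] at hid
  simp only [Real.dist_eq, id] at hunif hid ⊢
  intro ε hε
  have hweight : Tendsto (fun n : ℕ => α / (α + n) * K) atTop (𝓝 0) := by
    simpa using ((tendsto_const_nhds (x := α)).div_atTop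
      (tendsto_atTop_add_const_left _ α tendsto_natCast_atTop_atTop)).mul_const K
  filter_upwards [hunif (ε / 3) (by positivity), hid (ε / 3) (by positivity),
    hweight.eventually_lt_const (show 0 < ε / 3 by positivity)] with n hemp hφ hw θ
  have := hQprob n
  have hV := abs_integral_comp_sub_integral_le (μ := Qs n) hK.le (hφmono n).monotoneOn
    (fun t ht => (abs_sub_comm (φn n t) t).trans_le (hφ t ht).le)
    (fun p : ProbabilityMeasure Ξ =>
      integral_mem_Icc_of_forall_mem_Icc (μ := (p : Measure Ξ)) (hval θ) (hmeas θ))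
    (measurable_integral_probabilityMeasure (hmeas θ) fun ξ => (hval θ ξ).1)
  rw [hQmean n θ] at hV
  have hmix := abs_mixture_sub_le hα n (average_mem_Icc hK.le fun i => hval θ (ξs n i))
    (integral_mem_Icc_of_forall_mem_Icc (μ := p₀) (hval θ) (hmeas θ))
  have hA := abs_lt.1 (hemp θ)
  rw [abs_le] at hV hmix
  rw [abs_lt]
  constructor <;> linarith [hV.1, hV.2, hmix.1, hmix.2, hA.1, hA.2]
end
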